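/- Fix A ∈ ℝ and let L = L_A be the linearized Fermi–Dirac distribution. Let θ : [0, ∞) × ℝ² → ℝ satisfy the Milne equation v_x(p) ∂_ξ θ(ξ, p) = L(p) ⟨θ(ξ, ·)⟩ − θ(ξ, p) for all ξ ≥ 0 and a.e. p ∈ ℝ² \ {0}, with the same integrability, differentiability and local domination hypotheses as before, and suppose there exists n^∞ ∈ ℝ such that ∫_{ℝ²} |θ(ξ, p) − n^∞ L(p)| dp → 0 as ξ → +∞. Then for every ξ ≥ 0, ∫_{ℝ²} v_x(p)² θ(ξ, p) dp = (h² v_F²/2) n^∞; equivalently ⟨v_x² θ(ξ, ·)⟩ = (v_F²/2) n^∞. -/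

import Mathlib

open MeasureTheory Real Set Filter

noncomputable section

/-- Euclidean norm of `p ∈ ℝ²` (realized as `ℝ × ℝ`). -/
def pnorm (p : ℝ × ℝ) : ℝ := Real.sqrt (p.1 ^ 2 + p.2 ^ 2)

/-- `x`-component of the semiclassical velocity `v(p) = v_F p/|p|`. -/
def vx (vF : ℝ) (p : ℝ × ℝ) : ℝ := vF * p.1 / pnorm p

/-- Fermi integral of order `k`. -/
def fermiInt (k z : ℝ) : ℝ :=
  (1 / Real.Gamma k) * ∫ t in Set.Ioi (0 : ℝ), t ^ (k - 1) / (Real.exp (t - z) + 1)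

/-- The constant `n₀ = 2π/(β h v_F)²`. -/
def n0 (β vF h : ℝ) : ℝ := 2 * Real.pi / (β * h * vF) ^ 2

/-- Fermi–Dirac distribution with chemical potential `A`. -/
def FD (β vF A : ℝ) (p : ℝ × ℝ) : ℝ := 1 / (Real.exp (β * (vF * pnorm p - A)) + 1)

/-- Linearized Fermi–Dirac distribution. -/
def LFD (β vF h A : ℝ) (p : ℝ × ℝ) : ℝ :=
  (FD β vF A p) ^ 2 * Real.exp (β * (vF * pnorm p - A)) / (n0 β vF h * fermiInt 1 (β * A))

/-- A family that is a.e. measurable in the point and, for a.e. point, differentiable in the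
parameter, is jointly measurable off a null set, and so is its derivative. -/
lemma exists_null_measurable_uncurry {X : Type*} [MeasurableSpace X] {μ : Measure X} {a : ℝ}
    {f f' : ℝ → X → ℝ} (hf : ∀ t ∈ Ici a, AEMeasurable (f t) μ)
    (hf' : ∀ᵐ x ∂μ, ∀ t ∈ Ici a, HasDerivAt (fun s => f s x) (f' t x) t) :
    ∃ N : Set X, MeasurableSet N ∧ μ N = 0 ∧
      (∀ x ∉ N, ∀ t ∈ Ici a, HasDerivAt (fun s => f s x) (f' t x) t) ∧
      Measurable (Function.uncurry fun t => Nᶜ.indicator (f' (max a t))) := by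
  have hmem : ∀ t, max a t ∈ Ici a := fun t => le_max_left a t
  have hq : ∀ᵐ x ∂μ, ∀ q : ℚ, f (max a q) x = (hf (max a q) (hmem q)).mk _ x :=
    ae_all_iff.2 fun q => (hf (max a q) (hmem q)).ae_eq_mk
  obtain ⟨N, hsub, hN, hN0⟩ := exists_measurable_superset_of_null (ae_iff.1 (hf'.and hq))
  have hgood : ∀ x ∉ N, (∀ t ∈ Ici a, HasDerivAt (fun s => f s x) (f' t x) t) ∧
      ∀ q : ℚ, f (max a q) x = (hf (max a q) (hmem q)).mk _ x := fun x hx => by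
    by_contra hcon
    exact hx (hsub hcon)
  have hcont : ∀ x, Continuous fun t => Nᶜ.indicator (f (max a t)) x := by
    intro x
    by_cases hx : x ∈ N
    · simpa [hx] using continuous_const
    · simp only [mem_compl_iff, hx, not_false_eq_true, indicator_of_mem]
      refine continuous_iff_continuousAt.2 fun t => ?_
      have h1 := ((hgood x hx).1 (max a t) (hmem t)).continuousAt
      exact ContinuousAt.comp (f := fun t => max a t) (g := fun s => f s x) h1
        (continuous_const.max continuous_id).continuousAt
  have hrat : ∀ q : ℚ, Measurable (Nᶜ.indicator (f (max a q))) := by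
    intro q
    have : Nᶜ.indicator (f (max a q))
        = Nᶜ.indicator ((hf (max a q) (hmem q)).mk _) :=
      indicator_congr fun x hx => (hgood x hx).2 q
    rw [this]
    exact ((hf (max a q) (hmem q)).measurable_mk).indicator hN.compl
  have hmeas : ∀ t, Measurable (Nᶜ.indicator (f (max a t))) := by
    intro t
    obtain ⟨u, hu, hut⟩ := mem_closure_iff_seq_limit.1 (Rat.denseRange_cast (𝕜 := ℝ) t)
    choose q hq using hu
    refine measurable_of_tendsto_metrizable (f := fun n => Nᶜ.indicator (f (max a (u n))))
      (fun n => ?_) (tendsto_pi_nhds.2 fun x => ((hcont x).tendsto t).comp hut)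
    rw [← hq n]
    exact hrat (q n)
  have hjoint : Measurable (Function.uncurry fun t => Nᶜ.indicator (f (max a t))) :=
    (stronglyMeasurable_uncurry_of_continuous_of_stronglyMeasurable hcont
      fun t => (hmeas t).stronglyMeasurable).measurable
  refine ⟨N, hN, hN0, fun x hx => (hgood x hx).1, ?_⟩
  have hmax : Measurable fun z : ℝ × X => (max a z.1, z.2) := by fun_prop
  have hshift : ∀ n : ℕ, Measurable fun z : ℝ × X => (max a z.1 + 1 / ((n : ℝ) + 1), z.2) :=
    fun n => by fun_prop
  refine measurable_of_tendsto_metrizable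
    (f := fun (n : ℕ) (z : ℝ × X) => (1 / ((n : ℝ) + 1))⁻¹ *
      (Nᶜ.indicator (f (max a (max a z.1 + 1 / ((n : ℝ) + 1)))) z.2
        - Nᶜ.indicator (f (max a (max a z.1))) z.2))
    (fun n => ((hjoint.comp (hshift n)).sub (hjoint.comp hmax)).const_mul _)
    (tendsto_pi_nhds.2 fun z => ?_)
  obtain ⟨t, x⟩ := z
  by_cases hx : x ∈ N
  · simp [hx, Function.uncurry]
  · have hlim : Tendsto (fun n : ℕ => 1 / ((n : ℝ) + 1)) atTop (nhdsWithin 0 {0}ᶜ) :=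
      tendsto_nhdsWithin_iff.2 ⟨tendsto_one_div_add_atTop_nhds_zero_nat,
        Eventually.of_forall fun n => by
          have : (0 : ℝ) < 1 / ((n : ℝ) + 1) := by positivity
          exact this.ne'⟩
    have hd := ((hgood x hx).1 (max a t) (hmem t)).tendsto_slope_zero.comp hlim
    have hle : ∀ n : ℕ, a ≤ max a t + ((n : ℝ) + 1)⁻¹ := fun n => by
      have : (0 : ℝ) < ((n : ℝ) + 1)⁻¹ := by positivity
      linarith [le_max_left a t]
    simpa [Function.uncurry, hx, Function.comp_def, max_eq_right (hle _)] using hd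

/-- If a family is differentiable in its parameter with locally dominated derivative, and the
derivative integrates to zero against a bounded weight, then so does the increment. -/
lemma integral_mul_eq_of_integral_mul_deriv_eq_zero {X : Type*} [MeasurableSpace X]
    {μ : Measure X} [SFinite μ] {a b : ℝ} (hab : a ≤ b) {f f' : ℝ → X → ℝ} {φ g : X → ℝ} {C : ℝ}
    (hf : ∀ t ∈ Ici a, Integrable (f t) μ)
    (hf' : ∀ᵐ x ∂μ, ∀ t ∈ Ici a, HasDerivAt (fun s => f s x) (f' t x) t)
    (hg : Integrable g μ) (hbound : ∀ t ∈ Icc a b, ∀ᵐ x ∂μ, |f' t x| ≤ g x)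
    (hφ : Measurable φ) (hφC : ∀ x, |φ x| ≤ C)
    (hzero : ∀ t ∈ Icc a b, ∫ x, φ x * f' t x ∂μ = 0) :
    ∫ x, φ x * f b x ∂μ = ∫ x, φ x * f a x ∂μ := by
  obtain ⟨N, hN, hN0, hder, hmeas⟩ :=
    exists_null_measurable_uncurry (fun t ht => (hf t ht).aemeasurable) hf'
  set D : ℝ → X → ℝ := fun t => Nᶜ.indicator (f' (max a t)) with hD
  have hNae : ∀ᵐ x ∂μ, x ∉ N := measure_eq_zero_iff_ae_notMem.1 hN0
  have hDeq : ∀ t ∈ Icc a b, ∀ x ∉ N, D t x = f' t x := fun t ht x hx => by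
    simp [hD, hx, max_eq_right ht.1]
  set ν := (volume : Measure ℝ).restrict (Ioc a b)
  have hgae := hg.1.aemeasurable.ae_eq_mk
  have hbound' : ∀ᵐ z ∂(ν.prod μ), |D z.1 z.2| ≤ hg.1.aemeasurable.mk g z.2 := by
    have hset : MeasurableSet {z : ℝ × X | |D z.1 z.2| ≤ hg.1.aemeasurable.mk g z.2} :=
      measurableSet_le hmeas.abs (hg.1.aemeasurable.measurable_mk.comp measurable_snd)
    rw [Measure.ae_prod_iff_ae_ae hset]
    refine (ae_restrict_iff' measurableSet_Ioc).2 (Eventually.of_forall fun t ht => ?_)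
    have ht' : t ∈ Icc a b := Ioc_subset_Icc_self ht
    filter_upwards [hbound t ht', hNae, hgae] with x hx hxN hxg
    rw [← hxg, hDeq t ht' x hxN]
    exact hx
  have hgprod : Integrable (fun z : ℝ × X => C * hg.1.aemeasurable.mk g z.2) (ν.prod μ) :=
    ((hg.congr hgae).comp_snd ν).const_mul C
  have hint : Integrable (fun z : ℝ × X => φ z.2 * D z.1 z.2) (ν.prod μ) := by
    refine hgprod.mono' ((hφ.comp measurable_snd).mul hmeas).aestronglyMeasurable ?_
    filter_upwards [hbound'] with z hz
    rw [norm_mul, Real.norm_eq_abs, Real.norm_eq_abs]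
    exact mul_le_mul (hφC _) hz (abs_nonneg _) ((abs_nonneg _).trans (hφC z.2))
  have hDint : Integrable (Function.uncurry D) (ν.prod μ) :=
    ((hg.congr hgae).comp_snd ν).mono' hmeas.aestronglyMeasurable hbound'
  have hftc : ∀ᵐ x ∂μ, φ x * f b x - φ x * f a x = ∫ t, φ x * D t x ∂ν := by
    filter_upwards [hDint.prod_left_ae, hNae] with x hx hxN
    have hiv : IntervalIntegrable (fun t => D t x) volume a b :=
      (intervalIntegrable_iff_integrableOn_Ioc_of_le hab).2 hx
    have := intervalIntegral.integral_eq_sub_of_hasDerivAt (f := fun s => f s x)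
      (f' := fun t => D t x) (a := a) (b := b) (fun t ht => by
        rw [uIcc_of_le hab] at ht
        simpa only [hDeq t ht x hxN] using hder x hxN t ht.1) hiv
    rw [intervalIntegral.integral_of_le hab] at this
    rw [integral_const_mul, this]
    ring
  have hφf : ∀ t ∈ Ici a, Integrable (fun x => φ x * f t x) μ := fun t ht =>
    (hf t ht).bdd_mul hφ.aestronglyMeasurable (Eventually.of_forall hφC)
  rw [← sub_eq_zero, ← integral_sub (hφf b hab) (hφf a self_mem_Ici), integral_congr_ae hftc,
    ← integral_integral_swap (f := fun t x => φ x * D t x) hint]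
  refine setIntegral_eq_zero_of_forall_eq_zero fun t ht => ?_
  have ht' : t ∈ Icc a b := Ioc_subset_Icc_self ht
  rw [← hzero t ht']
  refine integral_congr_ae ?_
  filter_upwards [hNae] with x hx
  rw [hDeq t ht' x hx]

/-- Weak limits against bounded weights, deduced from `L¹` convergence. -/
lemma tendsto_integral_mul_of_tendsto_integral_abs_sub {X ι : Type*} [MeasurableSpace X]
    {μ : Measure X} {l : Filter ι} {f : ι → X → ℝ} {f₀ φ : X → ℝ} {C : ℝ}
    (hf : ∀ᶠ t in l, Integrable (f t) μ) (hf₀ : Integrable f₀ μ)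
    (hφ : Measurable φ) (hφC : ∀ x, |φ x| ≤ C)
    (hlim : Tendsto (fun t => ∫ x, |f t x - f₀ x| ∂μ) l (nhds 0)) :
    Tendsto (fun t => ∫ x, φ x * f t x ∂μ) l (nhds (∫ x, φ x * f₀ x ∂μ)) := by
  have hmul : ∀ {u : X → ℝ}, Integrable u μ → Integrable (fun x => φ x * u x) μ := fun hu =>
    hu.bdd_mul hφ.aestronglyMeasurable (Eventually.of_forall hφC)
  rw [tendsto_iff_norm_sub_tendsto_zero]
  have hC : Tendsto (fun t => C * ∫ x, |f t x - f₀ x| ∂μ) l (nhds 0) := by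
    simpa using hlim.const_mul C
  refine squeeze_zero' (Eventually.of_forall fun _ => norm_nonneg _) ?_ hC
  filter_upwards [hf] with t ht
  rw [← integral_sub (hmul ht) (hmul hf₀), ← integral_const_mul]
  refine norm_integral_le_of_norm_le ((ht.sub hf₀).abs.const_mul C)
    (Eventually.of_forall fun x => ?_)
  rw [← mul_sub, norm_mul, Real.norm_eq_abs, Real.norm_eq_abs]
  exact mul_le_mul_of_nonneg_right (hφC x) (abs_nonneg _)

@[fun_prop]
lemma measurable_pnorm : Measurable pnorm := by
  unfold pnorm
  fun_prop

@[fun_prop]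
lemma measurable_vx (vF : ℝ) : Measurable (vx vF) := by
  unfold vx
  fun_prop

lemma pnorm_neg (p : ℝ × ℝ) : pnorm (-p) = pnorm p := by simp [pnorm]

lemma pnorm_swap (p : ℝ × ℝ) : pnorm p.swap = pnorm p := by simp [pnorm, add_comm]

lemma pnorm_sq (p : ℝ × ℝ) : pnorm p ^ 2 = p.1 ^ 2 + p.2 ^ 2 := Real.sq_sqrt (by positivity)

lemma pnorm_nonneg (p : ℝ × ℝ) : 0 ≤ pnorm p := Real.sqrt_nonneg _

lemma pnorm_polarCoord_symm {z : ℝ × ℝ} (hz : 0 < z.1) : pnorm (polarCoord.symm z) = z.1 := by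
  rw [pnorm, polarCoord_symm_apply, Real.sqrt_eq_iff_mul_self_eq (by positivity) hz.le]
  linear_combination z.1 ^ 2 * Real.sin_sq_add_cos_sq z.2

lemma abs_vx_le {vF : ℝ} (hvF : 0 ≤ vF) (p : ℝ × ℝ) : |vx vF p| ≤ vF := by
  have h1 : |p.1| ≤ pnorm p :=
    Real.abs_le_sqrt (by nlinarith [sq_nonneg p.2])
  rw [vx, abs_div, abs_mul, abs_of_nonneg hvF, abs_of_nonneg (pnorm_nonneg p), mul_div_assoc]
  exact mul_le_of_le_one_right hvF (div_le_one_of_le₀ h1 (pnorm_nonneg p))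

lemma abs_vx_sq_le {vF : ℝ} (hvF : 0 ≤ vF) (p : ℝ × ℝ) : |vx vF p ^ 2| ≤ vF ^ 2 := by
  rw [abs_pow]
  exact pow_le_pow_left₀ (abs_nonneg _) (abs_vx_le hvF p) 2

lemma vx_neg (vF : ℝ) (p : ℝ × ℝ) : vx vF (-p) = -vx vF p := by
  simp [vx, pnorm_neg, neg_div]

lemma vx_sq_add_vx_swap_sq (vF : ℝ) {p : ℝ × ℝ} (hp : p ≠ 0) :
    vx vF p ^ 2 + vx vF p.swap ^ 2 = vF ^ 2 := by
  have h0 : p.1 ^ 2 + p.2 ^ 2 ≠ 0 := by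
    contrapose! hp
    have h1 : p.1 = 0 := by nlinarith [sq_nonneg p.1, sq_nonneg p.2]
    have h2 : p.2 = 0 := by nlinarith [sq_nonneg p.1, sq_nonneg p.2]
    exact Prod.ext h1 h2
  simp only [vx, pnorm_swap, div_pow, pnorm_sq, Prod.fst_swap]
  field_simp

/-- The complete Fermi integral of order one. -/
lemma fermiInt_one (z : ℝ) : fermiInt 1 z = Real.log (1 + Real.exp z) := by
  have hpos : ∀ t : ℝ, 0 < 1 + Real.exp (z - t) := fun t => by positivity
  have hder : ∀ t ∈ Ici (0 : ℝ), HasDerivAt (fun t => -Real.log (1 + Real.exp (z - t)))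
      (1 / (Real.exp (t - z) + 1)) t := fun t _ => by
    refine (((((hasDerivAt_id t).const_sub z).exp).const_add 1).log (hpos t).ne').neg.congr_deriv ?_
    have : Real.exp (t - z) = (Real.exp (z - t))⁻¹ := by rw [← Real.exp_neg]; ring_nf
    rw [this]
    have := Real.exp_pos (z - t)
    simp only [id]
    field_simp
  have hlim : Tendsto (fun t => -Real.log (1 + Real.exp (z - t))) atTop (nhds 0) := by
    have h1 : Tendsto (fun t => z - t) atTop atBot :=
      tendsto_const_nhds.add_atBot tendsto_neg_atTop_atBot
    have h2 : Tendsto (fun t => 1 + Real.exp (z - t)) atTop (nhds (1 + 0)) :=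
      (Real.tendsto_exp_atBot.comp h1).const_add 1
    simpa using (h2.log (by norm_num)).neg
  have := integral_Ioi_of_hasDerivAt_of_nonneg' hder (fun t _ => by positivity) hlim
  simp only [fermiInt, Real.Gamma_one, sub_self, Real.rpow_zero, div_one, one_mul]
  simpa using this

lemma fermiInt_one_pos (z : ℝ) : 0 < fermiInt 1 z := by
  rw [fermiInt_one]
  exact Real.log_pos (by linarith [Real.exp_pos z])

/-- The radial moment of the derivative of the Fermi function. -/
lemma integral_mul_fermi_deriv {c : ℝ} (hc : 0 < c) (z : ℝ) :
    ∫ r in Ioi (0 : ℝ), r * ((1 / (Real.exp (c * r - z) + 1)) ^ 2 * Real.exp (c * r - z))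
      = Real.log (1 + Real.exp z) / c ^ 2 := by
  have hs : ∀ r : ℝ, HasDerivAt (fun r => c * r - z) c r := fun r => by
    simpa using ((hasDerivAt_id r).const_mul c).sub_const z
  have hder : ∀ r ∈ Ici (0 : ℝ), HasDerivAt
      (fun r => -(r / (Real.exp (c * r - z) + 1) / c)
        - Real.log (1 + Real.exp (-(c * r - z))) / c ^ 2)
      (r * ((1 / (Real.exp (c * r - z) + 1)) ^ 2 * Real.exp (c * r - z))) r := fun r _ => by
    have h1 : Real.exp (c * r - z) + 1 ≠ 0 := by positivity
    have h2 : 1 + Real.exp (-(c * r - z)) ≠ 0 := by positivity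
    refine (((((hasDerivAt_id r).div ((hs r).exp.add_const 1) h1).div_const c).neg).sub
      ((((hs r).neg.exp.const_add 1).log h2).div_const (c ^ 2))).congr_deriv ?_
    have := Real.exp_pos (c * r - z)
    simp only [id, Pi.neg_apply, Real.exp_neg]
    field_simp
    ring
  have hlin : Tendsto (fun r => c * r - z) atTop atTop :=
    tendsto_atTop_add_const_right _ _ (tendsto_id.const_mul_atTop hc)
  have hlim : Tendsto (fun r => -(r / (Real.exp (c * r - z) + 1) / c)
      - Real.log (1 + Real.exp (-(c * r - z))) / c ^ 2) atTop (nhds 0) := by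
    have h2 : Tendsto (fun r => 1 + Real.exp (-(c * r - z))) atTop (nhds (1 + 0)) :=
      (Real.tendsto_exp_neg_atTop_nhds_zero.comp hlin).const_add 1
    have h3 : Tendsto (fun r : ℝ => r / (Real.exp (c * r - z) + 1)) atTop (nhds 0) := by
      have h4 : Tendsto (fun r : ℝ => (r ^ (1 : ℝ) * Real.exp (-c * r)) * Real.exp z)
          atTop (nhds (0 * Real.exp z)) :=
        (tendsto_rpow_mul_exp_neg_mul_atTop_nhds_zero 1 c hc).mul_const _
      rw [zero_mul] at h4
      refine squeeze_zero' ?_ ?_ h4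
      · filter_upwards [eventually_ge_atTop 0] with r hr
        positivity
      · filter_upwards [eventually_ge_atTop 0] with r hr
        rw [Real.rpow_one, mul_assoc, ← Real.exp_add, div_eq_mul_inv]
        refine mul_le_mul_of_nonneg_left ?_ hr
        rw [show -c * r + z = -(c * r - z) by ring, Real.exp_neg]
        exact inv_anti₀ (Real.exp_pos _) (by linarith)
    simpa using ((h3.div_const c).neg).sub ((h2.log (by norm_num)).div_const (c ^ 2))
  have := integral_Ioi_of_hasDerivAt_of_nonneg' hder
    (fun r hr => by have : (0 : ℝ) < r := hr; positivity) hlim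
  simpa using this

lemma LFD_eq_of_pnorm_eq {β vF h : ℝ} (A : ℝ) {p q : ℝ × ℝ} (hpq : pnorm p = pnorm q) :
    LFD β vF h A p = LFD β vF h A q := by
  simp only [LFD, FD, hpq]

lemma integral_LFD {β vF h : ℝ} (hβ : 0 < β) (hvF : 0 < vF) (hh : 0 < h)
    (A : ℝ) : ∫ p, LFD β vF h A p = h ^ 2 := by
  rw [← integral_comp_polarCoord_symm]
  have hcongr : ∀ z ∈ polarCoord.target, z.1 • LFD β vF h A (polarCoord.symm z)
      = (z.1 * ((1 / (Real.exp (β * vF * z.1 - β * A) + 1)) ^ 2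
          * Real.exp (β * vF * z.1 - β * A))) * (1 / (n0 β vF h * fermiInt 1 (β * A))) := by
    intro z hz
    have hz1 : 0 < z.1 := hz.1
    rw [smul_eq_mul, LFD, FD, pnorm_polarCoord_symm hz1,
      show β * (vF * z.1 - A) = β * vF * z.1 - β * A by ring]
    ring
  rw [setIntegral_congr_fun polarCoord.open_target.measurableSet hcongr, polarCoord_target,
    Measure.volume_eq_prod, setIntegral_prod_mul (fun r => r * ((1 / (Real.exp (β * vF * r - β * A)
      + 1)) ^ 2 * Real.exp (β * vF * r - β * A))) (fun _ => 1 / (n0 β vF h * fermiInt 1 (β * A))),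
    integral_mul_fermi_deriv (mul_pos hβ hvF), ← fermiInt_one, setIntegral_const]
  have hF := fermiInt_one_pos (β * A)
  have hπ := Real.pi_pos
  simp only [Real.volume_real_Ioo_of_le (by linarith : -Real.pi ≤ Real.pi), smul_eq_mul, n0]
  field_simp
  ring

lemma integrable_LFD {β vF h : ℝ} (hβ : 0 < β) (hvF : 0 < vF) (hh : 0 < h)
    (A : ℝ) : Integrable (LFD β vF h A) := by
  by_contra hcon
  have h1 := integral_LFD hβ hvF hh A
  rw [integral_undef hcon] at h1
  exact (pow_pos hh 2).ne h1

lemma integral_vx_mul_LFD {β vF h : ℝ} (A : ℝ) : ∫ p, vx vF p * LFD β vF h A p = 0 := by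
  have h1 := integral_neg_eq_self (fun p => vx vF p * LFD β vF h A p) (volume : Measure (ℝ × ℝ))
  simp only [vx_neg, LFD_eq_of_pnorm_eq A (pnorm_neg _), neg_mul, integral_neg] at h1
  linarith

lemma integral_vx_sq_mul_LFD {β vF h : ℝ} (hβ : 0 < β) (hvF : 0 < vF) (hh : 0 < h)
    (A : ℝ) :
    ∫ p, vx vF p ^ 2 * LFD β vF h A p = h ^ 2 * vF ^ 2 / 2 := by
  have hL := integrable_LFD hβ hvF hh A
  have hswap : ∫ p : ℝ × ℝ, vx vF p.swap ^ 2 * LFD β vF h A p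
      = ∫ p, vx vF p ^ 2 * LFD β vF h A p := by
    have h1 := integral_prod_swap (μ := (volume : Measure ℝ)) (ν := (volume : Measure ℝ))
      (fun p => vx vF p ^ 2 * LFD β vF h A p)
    simpa only [LFD_eq_of_pnorm_eq A (pnorm_swap _), ← Measure.volume_eq_prod] using h1
  have hi1 : Integrable fun p => vx vF p ^ 2 * LFD β vF h A p :=
    hL.bdd_mul ((measurable_vx vF).pow_const 2).aestronglyMeasurable
      (Eventually.of_forall (abs_vx_sq_le hvF.le))
  have hi2 : Integrable fun p : ℝ × ℝ => vx vF p.swap ^ 2 * LFD β vF h A p :=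
    hL.bdd_mul (((measurable_vx vF).comp measurable_swap).pow_const 2).aestronglyMeasurable
      (Eventually.of_forall fun p => abs_vx_sq_le hvF.le p.swap)
  have hsum : ∫ p : ℝ × ℝ, (vx vF p ^ 2 * LFD β vF h A p + vx vF p.swap ^ 2 * LFD β vF h A p)
      = vF ^ 2 * h ^ 2 := by
    rw [← integral_LFD hβ hvF hh A, ← integral_const_mul]
    refine integral_congr_ae ?_
    filter_upwards [Measure.ae_ne volume (0 : ℝ × ℝ)] with p hp
    rw [← add_mul, vx_sq_add_vx_swap_sq vF hp]
  rw [integral_add hi1 hi2, hswap] at hsum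
  linarith

/-- On the half-line `[0,∞)`, if a solution of the Milne equation with `L = L_A` relaxes in `L¹`
to `n^∞ L_A`, then its variance is everywhere equal to `(h² v_F²/2) n^∞`. -/
theorem stmt18 (β vF h : ℝ) (hβ : 0 < β) (hvF : 0 < vF) (hh : 0 < h) (A : ℝ)
    (θ Dθ : ℝ → ℝ × ℝ → ℝ)
    (hθint : ∀ ξ ∈ Set.Ici (0 : ℝ), Integrable (θ ξ))
    (hderiv : ∀ᵐ p : ℝ × ℝ, ∀ ξ ∈ Set.Ici (0 : ℝ), HasDerivAt (fun ζ => θ ζ p) (Dθ ξ p) ξ)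
    (hdom : ∀ a b : ℝ, Set.Icc a b ⊆ Set.Ici (0 : ℝ) → ∃ g : ℝ × ℝ → ℝ, Integrable g ∧
      ∀ ξ ∈ Set.Icc a b, ∀ᵐ p : ℝ × ℝ, |θ ξ p| ≤ g p ∧ |Dθ ξ p| ≤ g p)
    (hMilne : ∀ ξ ∈ Set.Ici (0 : ℝ), ∀ᵐ p : ℝ × ℝ, p ≠ 0 →
      vx vF p * Dθ ξ p
        = LFD β vF h A p * ((1 / h ^ 2) * ∫ q : ℝ × ℝ, θ ξ q) - θ ξ p)
    (ninf : ℝ)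
    (hrelax : Tendsto (fun ξ => ∫ p : ℝ × ℝ, |θ ξ p - ninf * LFD β vF h A p|)
      atTop (nhds 0)) :
    ∀ ξ ∈ Set.Ici (0 : ℝ),
      ∫ p : ℝ × ℝ, (vx vF p) ^ 2 * θ ξ p = (h ^ 2 * vF ^ 2 / 2) * ninf := by
  have hL := integrable_LFD hβ hvF hh A
  have hvm := measurable_vx vF
  have hvC := abs_vx_le hvF.le
  have hv2m : Measurable fun p => vx vF p ^ 2 := hvm.pow_const 2
  have hv2C := abs_vx_sq_le hvF.le
  have hMilne' : ∀ ξ ∈ Ici (0 : ℝ), ∀ᵐ p : ℝ × ℝ, vx vF p * Dθ ξ p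
      = LFD β vF h A p * ((1 / h ^ 2) * ∫ q : ℝ × ℝ, θ ξ q) - θ ξ p := fun ξ hξ => by
    filter_upwards [hMilne ξ hξ, Measure.ae_ne volume (0 : ℝ × ℝ)] with p hp h0 using hp h0
  have hflux' : ∀ ξ ∈ Ici (0 : ℝ), ∫ p, vx vF p * Dθ ξ p = 0 := fun ξ hξ => by
    rw [integral_congr_ae (hMilne' ξ hξ), integral_sub (hL.mul_const _) (hθint ξ hξ),
      integral_mul_const, integral_LFD hβ hvF hh A]
    field_simp
    ring
  -- Moments against a bounded weight that the equation conserves equal their limit at infinity.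
  have hmoment : ∀ (φ : ℝ × ℝ → ℝ) (C : ℝ), Measurable φ → (∀ p, |φ p| ≤ C) →
      (∀ ξ ∈ Ici (0 : ℝ), ∫ p, φ p * Dθ ξ p = 0) →
      ∀ ξ ∈ Ici (0 : ℝ), ∫ p, φ p * θ ξ p = ninf * ∫ p, φ p * LFD β vF h A p := by
    intro φ C hφ hφC hzero ξ hξ
    have hsub : Ici ξ ⊆ Ici (0 : ℝ) := Ici_subset_Ici.2 hξ
    have hlim := tendsto_integral_mul_of_tendsto_integral_abs_sub
      (by filter_upwards [eventually_ge_atTop 0] with η hη using hθint η hη)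
      (hL.const_mul ninf) hφ hφC hrelax
    have hev : ∀ᶠ η in atTop, ∫ p, φ p * θ ξ p = ∫ p, φ p * θ η p := by
      filter_upwards [eventually_ge_atTop ξ] with η hη
      obtain ⟨g, hg, hgb⟩ := hdom ξ η (Icc_subset_Ici_self.trans hsub)
      exact (integral_mul_eq_of_integral_mul_deriv_eq_zero hη (fun t ht => hθint t (hsub ht))
        (hderiv.mono fun p hp t ht => hp t (hsub ht)) hg
        (fun t ht => (hgb t ht).mono fun p hp => hp.2) hφ hφC
        fun t ht => hzero t (hsub ht.1)).symm
    rw [tendsto_nhds_unique (tendsto_const_nhds.congr' hev) hlim, ← integral_const_mul]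
    simp only [mul_left_comm]
  have hflux := hmoment _ _ hvm hvC hflux'
  simp only [integral_vx_mul_LFD, mul_zero] at hflux
  have hvar : ∀ ξ ∈ Ici (0 : ℝ), ∫ p, vx vF p ^ 2 * Dθ ξ p = 0 := fun ξ hξ => by
    have hcongr : ∀ᵐ p : ℝ × ℝ, vx vF p ^ 2 * Dθ ξ p
        = vx vF p * LFD β vF h A p * ((1 / h ^ 2) * ∫ q : ℝ × ℝ, θ ξ q)
          - vx vF p * θ ξ p := by
      filter_upwards [hMilne' ξ hξ] with p hp
      linear_combination vx vF p * hp
    rw [integral_congr_ae hcongr, integral_sub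
      ((hL.bdd_mul hvm.aestronglyMeasurable (Eventually.of_forall hvC)).mul_const _)
      ((hθint ξ hξ).bdd_mul hvm.aestronglyMeasurable (Eventually.of_forall hvC)),
      integral_mul_const, integral_vx_mul_LFD, hflux ξ hξ]
    ring
  intro ξ hξ
  rw [hmoment _ _ hv2m hv2C hvar ξ hξ, integral_vx_sq_mul_LFD hβ hvF hh A, mul_comm]
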